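/- Let 1 < α < 2, let β satisfy α-1 ≤ β ≤ 1, set λ_n := [sin(πα)/(sin(π(α-β)) + sin(πβ))]·Γ(n+α)/n!, let f : (0,1) → ℝ satisfy ∫₀¹ ρ^{(β-1,α-β-1)} f² < ∞, and define f_i := ∫₀¹ ρ^{(β-1,α-β-1)}(x) f(x) G_i^{(β-1,α-β-1)}(x) dx and c_i := f_{i+1}/(λ_i·|‖G_{i+1}^{(β-1,α-β-1)}‖|²) for i ≥ 0. Then there exists a constant C > 0, depending only on α and β, such that for all integers M > N ≥ 1, ∫₀¹ ρ^{(-(α-β+1), -(β+1))}(x) ( ∫₀^x ρ^{(α-β,β)}(s) Σ_{i=N}^{M-1} c_i G_i^{(α-β,β)}(s) ds )² dx ≤ C · N^{-2} (N+1)^{-2(α-1)} · Σ_{i=N+1}^{M} f_i² / |‖G_i^{(β-1,α-β-1)}‖|². -/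

import Mathlib

open Real MeasureTheory

/-- Jacobi polynomial `P_n^{(a,b)}(x)`. -/
noncomputable def jacobiP (a b : ℝ) (n : ℕ) (x : ℝ) : ℝ :=
  ∑ m ∈ Finset.range (n + 1),
    (1 / 2 ^ n : ℝ) *
      (Real.Gamma ((n : ℝ) + a + 1) /
        (Real.Gamma ((m : ℝ) + 1) * Real.Gamma ((n : ℝ) + a - (m : ℝ) + 1))) *
      (Real.Gamma ((n : ℝ) + b + 1) /
        (Real.Gamma ((n : ℝ) - (m : ℝ) + 1) * Real.Gamma (b + (m : ℝ) + 1))) *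
      (x - 1) ^ (n - m) * (x + 1) ^ m

/-- Shifted Jacobi polynomial `G_n^{(a,b)}(t) = P_n^{(a,b)}(2t-1)`. -/
noncomputable def jacobiG (a b : ℝ) (n : ℕ) (t : ℝ) : ℝ :=
  jacobiP a b n (2 * t - 1)

/-- Square of the norm constant `|‖G_n^{(a,b)}‖|`. -/
noncomputable def Gnorm2 (a b : ℝ) (n : ℕ) : ℝ :=
  Real.Gamma ((n : ℝ) + a + 1) * Real.Gamma ((n : ℝ) + b + 1) /
    ((2 * (n : ℝ) + a + b + 1) * Real.Gamma ((n : ℝ) + 1) * Real.Gamma ((n : ℝ) + a + b + 1))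

/-- The weight function `ρ^{(a,b)}(x) = (1-x)^a x^b`. -/
noncomputable def rho (a b x : ℝ) : ℝ := (1 - x) ^ a * x ^ b

/-- The eigenvalue `λ_n = [sin(πα)/(sin(π(α-β))+sin(πβ))]·Γ(n+α)/n!`. -/
noncomputable def lamda (α β : ℝ) (n : ℕ) : ℝ :=
  Real.sin (π * α) / (Real.sin (π * (α - β)) + Real.sin (π * β)) *
    (Real.Gamma ((n : ℝ) + α) / (n.factorial : ℝ))

/-- The coefficient of `(t - 1) ^ (n - m) * t ^ m` in `G_n^{(a,b)}(t)`. -/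
noncomputable def jacobiCoeff (a b : ℝ) (n m : ℕ) : ℝ :=
  Real.Gamma ((n : ℝ) + a + 1) /
      (Real.Gamma ((m : ℝ) + 1) * Real.Gamma ((n : ℝ) + a - (m : ℝ) + 1)) *
    (Real.Gamma ((n : ℝ) + b + 1) /
      (Real.Gamma ((n : ℝ) - (m : ℝ) + 1) * Real.Gamma (b + (m : ℝ) + 1)))

lemma jacobiG_eq_sum (a b : ℝ) (n : ℕ) (t : ℝ) :
    jacobiG a b n t =
      ∑ m ∈ Finset.range (n + 1), jacobiCoeff a b n m * ((t - 1) ^ (n - m) * t ^ m) := by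
  unfold jacobiG jacobiP jacobiCoeff
  refine Finset.sum_congr rfl fun m hm => ?_
  have hmn : m ≤ n := Nat.lt_succ_iff.mp (Finset.mem_range.mp hm)
  have hpow : (2 * t - 1 - 1) ^ (n - m) * (2 * t - 1 + 1) ^ m
      = 2 ^ n * ((t - 1) ^ (n - m) * t ^ m) := by
    rw [show 2 * t - 1 - 1 = 2 * (t - 1) by ring, show 2 * t - 1 + 1 = 2 * t by ring,
      mul_pow, mul_pow, show (2 : ℝ) ^ n = 2 ^ (n - m) * 2 ^ m by
        rw [← pow_add, Nat.sub_add_cancel hmn]]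
    ring
  rw [mul_assoc _ ((2 * t - 1 - 1) ^ (n - m)), hpow]
  field_simp

lemma continuous_jacobiG (a b : ℝ) (n : ℕ) : Continuous (jacobiG a b n) := by
  unfold jacobiG jacobiP
  fun_prop

lemma continuous_rho {a b : ℝ} (ha : 0 ≤ a) (hb : 0 ≤ b) : Continuous (rho a b) := by
  unfold rho
  exact ((continuous_const.sub continuous_id).rpow_const fun _ => Or.inr ha).mul
    (continuous_id.rpow_const fun _ => Or.inr hb)

lemma jacobiG_zero {a b : ℝ} (ha : 0 ≤ a) (hb : 0 ≤ b) (t : ℝ) : jacobiG a b 0 t = 1 := by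
  have h1 : Real.Gamma (a + 1) ≠ 0 := (Real.Gamma_pos_of_pos (by linarith)).ne'
  have h2 : Real.Gamma (b + 1) ≠ 0 := (Real.Gamma_pos_of_pos (by linarith)).ne'
  simp [jacobiG_eq_sum, jacobiCoeff, h1, h2]

/-- Contiguity relation in the exponent of `t`. -/
lemma jacobiCoeff_succ_succ_mul {a b : ℝ} (hb : 0 ≤ b) {n m : ℕ} (hm : m ≤ n) :
    (b + 1 + m) * jacobiCoeff (a + 1) (b + 1) n m =
      ((n + 1 : ℝ) - m) * jacobiCoeff a b (n + 1) m := by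
  have hmn : (m : ℝ) ≤ n := by exact_mod_cast hm
  have hm0 : (0 : ℝ) ≤ m := m.cast_nonneg
  unfold jacobiCoeff
  have e1 : Real.Gamma (b + 1 + (m : ℝ) + 1) = (b + 1 + m) * Real.Gamma (b + m + 1) := by
    rw [Real.Gamma_add_one (by positivity), show b + 1 + (m : ℝ) = b + m + 1 by ring]
  have e2 : Real.Gamma ((n : ℝ) + 1 - m + 1) = (n + 1 - m) * Real.Gamma (n - m + 1) := by
    rw [Real.Gamma_add_one (by linarith), show (n : ℝ) + 1 - m = n - m + 1 by ring]
  push_cast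
  rw [e1, e2, show (n : ℝ) + (a + 1) + 1 = n + 1 + a + 1 by ring,
    show (n : ℝ) + (b + 1) + 1 = n + 1 + b + 1 by ring,
    show (n : ℝ) + (a + 1) - m + 1 = n + 1 + a - m + 1 by ring]
  have h1 : b + 1 + (m : ℝ) ≠ 0 := by positivity
  have h2 : (n : ℝ) + 1 - m ≠ 0 := by linarith
  generalize (n : ℝ) + 1 - m = p at *
  generalize b + 1 + (m : ℝ) = q at *
  simp only [div_eq_mul_inv, mul_inv]
  field_simp

/-- Contiguity relation in the exponent of `t - 1`. -/
lemma jacobiCoeff_succ_succ_mul_shift {a b : ℝ} (ha : 0 ≤ a) {n m : ℕ} (hm : m ≤ n) :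
    (a + 1 + n - m) * jacobiCoeff (a + 1) (b + 1) n m =
      ((m : ℝ) + 1) * jacobiCoeff a b (n + 1) (m + 1) := by
  have hmn : (m : ℝ) ≤ n := by exact_mod_cast hm
  have hm0 : (0 : ℝ) ≤ m := m.cast_nonneg
  unfold jacobiCoeff
  have e1 : Real.Gamma ((n : ℝ) + (a + 1) - m + 1) =
      (a + 1 + n - m) * Real.Gamma (n + a - m + 1) := by
    rw [Real.Gamma_add_one (by linarith), show (n : ℝ) + (a + 1) - m = n + a - m + 1 by ring]
    ring
  have e2 : Real.Gamma ((m : ℝ) + 1 + 1) = (m + 1) * Real.Gamma (m + 1) :=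
    Real.Gamma_add_one (by positivity)
  push_cast
  rw [e1, e2, show (n : ℝ) + (a + 1) + 1 = n + 1 + a + 1 by ring,
    show (n : ℝ) + (b + 1) + 1 = n + 1 + b + 1 by ring,
    show (n : ℝ) + 1 + a - (m + 1) + 1 = n + a - m + 1 by ring,
    show (n : ℝ) + 1 - (m + 1) + 1 = n - m + 1 by ring,
    show b + ((m : ℝ) + 1) + 1 = b + 1 + m + 1 by ring]
  have h1 : a + 1 + (n : ℝ) - m ≠ 0 := by linarith
  have h2 : (m : ℝ) + 1 ≠ 0 := by positivity
  generalize a + 1 + (n : ℝ) - m = p at *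
  simp only [div_eq_mul_inv, mul_inv]
  field_simp

/-- The derivative of `G_{n+1}^{(a,b)}` is a multiple of `G_n^{(a+1,b+1)}`. -/
lemma hasDerivAt_jacobiG_succ {a b : ℝ} (ha : 0 ≤ a) (hb : 0 ≤ b) (n : ℕ) (t : ℝ) :
    HasDerivAt (jacobiG a b (n + 1))
      (((n : ℝ) + a + b + 2) * jacobiG (a + 1) (b + 1) n t) t := by
  have hfun : jacobiG a b (n + 1) = fun t => ∑ m ∈ Finset.range (n + 1 + 1),
      jacobiCoeff a b (n + 1) m * ((t - 1) ^ (n + 1 - m) * t ^ m) :=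
    funext fun t => jacobiG_eq_sum a b (n + 1) t
  have hterm : ∀ m ∈ Finset.range (n + 1 + 1), HasDerivAt
      (fun t : ℝ => jacobiCoeff a b (n + 1) m * ((t - 1) ^ (n + 1 - m) * t ^ m))
      (jacobiCoeff a b (n + 1) m * (((n + 1 - m : ℕ) : ℝ) * (t - 1) ^ (n + 1 - m - 1) * t ^ m
        + (t - 1) ^ (n + 1 - m) * ((m : ℝ) * t ^ (m - 1)))) t := by
    intro m _
    have h1 := ((hasDerivAt_id' t).sub_const 1).fun_pow (n + 1 - m)
    have h2 := (hasDerivAt_id' t).fun_pow m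
    refine ((h1.fun_mul h2).const_mul (jacobiCoeff a b (n + 1) m)).congr_deriv ?_
    simp only [mul_one]
  rw [hfun]
  refine (HasDerivAt.fun_sum hterm).congr_deriv ?_
  simp only [mul_add, Finset.sum_add_distrib]
  rw [Finset.sum_range_succ, Finset.sum_range_succ' (fun m => jacobiCoeff a b (n + 1) m *
    ((t - 1) ^ (n + 1 - m) * ((m : ℝ) * t ^ (m - 1))))]
  simp only [Nat.sub_self, Nat.cast_zero, zero_mul, mul_zero, add_zero]
  rw [← Finset.sum_add_distrib, jacobiG_eq_sum, Finset.mul_sum]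
  refine Finset.sum_congr rfl fun m hm => ?_
  have hmn : m ≤ n := Nat.lt_succ_iff.mp (Finset.mem_range.mp hm)
  have r1 := jacobiCoeff_succ_succ_mul (a := a) hb hmn
  have r2 := jacobiCoeff_succ_succ_mul_shift (b := b) ha hmn
  rw [Nat.add_sub_add_right, Nat.add_sub_cancel, Nat.cast_sub (by omega),
    show n + 1 - m - 1 = n - m by omega]
  push_cast
  linear_combination (-((t - 1) ^ (n - m) * t ^ m)) * (r1 + r2)

/-- Lowering form of the Rodrigues formula for the shifted Jacobi polynomials. -/
lemma hasDerivAt_rho_mul_jacobiG {a b : ℝ} (ha : 0 ≤ a) (hb : 0 ≤ b) (n : ℕ) {t : ℝ}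
    (ht0 : 0 ≤ t) (ht1 : t ≤ 1) :
    HasDerivAt (fun t => rho (a + 1) (b + 1) t * jacobiG (a + 1) (b + 1) n t)
      (-((n : ℝ) + 1) * (rho a b t * jacobiG a b (n + 1) t)) t := by
  have hfun : (fun t => rho (a + 1) (b + 1) t * jacobiG (a + 1) (b + 1) n t) =
      fun t => ∑ m ∈ Finset.range (n + 1), jacobiCoeff (a + 1) (b + 1) n m *
        (((1 - t) ^ (a + 1) * t ^ (b + 1)) * ((t - 1) ^ (n - m) * t ^ m)) := by
    funext t
    rw [jacobiG_eq_sum, Finset.mul_sum, rho]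
    exact Finset.sum_congr rfl fun m _ => by ring
  have hpred : ∀ (k : ℕ) (y : ℝ), (k : ℝ) * y ^ (k - 1) * y = k * y ^ k := by
    intro k y
    cases k with
    | zero => simp
    | succ k => simp only [Nat.add_sub_cancel, pow_succ]; ring
  have hterm : ∀ m ∈ Finset.range (n + 1), HasDerivAt
      (fun t : ℝ => jacobiCoeff (a + 1) (b + 1) n m *
        (((1 - t) ^ (a + 1) * t ^ (b + 1)) * ((t - 1) ^ (n - m) * t ^ m)))
      (-(rho a b t) * (jacobiCoeff (a + 1) (b + 1) n m *
        ((a + 1 + n - m) * ((t - 1) ^ (n - m) * t ^ (m + 1)) +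
          (b + 1 + m) * ((t - 1) ^ (n + 1 - m) * t ^ m)))) t := by
    intro m hm
    have hmn : m ≤ n := Nat.lt_succ_iff.mp (Finset.mem_range.mp hm)
    have h1 := ((hasDerivAt_id' t).sub_const 1).fun_pow (n - m)
    have h2 := (hasDerivAt_id' t).fun_pow m
    have h3 := ((hasDerivAt_id' t).const_sub 1).rpow_const (p := a + 1) (Or.inr (by linarith))
    have h4 := (hasDerivAt_id' t).rpow_const (p := b + 1) (Or.inr (by linarith))
    refine (((h3.fun_mul h4).fun_mul (h1.fun_mul h2)).const_mul
      (jacobiCoeff (a + 1) (b + 1) n m)).congr_deriv ?_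
    have e3 : (1 - t) ^ (a + 1) = (1 - t) ^ a * (1 - t) :=
      Real.rpow_add_one' (by linarith) (by linarith)
    have e4 : t ^ (b + 1) = t ^ b * t := Real.rpow_add_one' ht0 (by linarith)
    have p1 := hpred (n - m) (t - 1)
    have p2 := hpred m t
    have hc : ((n - m : ℕ) : ℝ) = n - m := Nat.cast_sub hmn
    simp only [add_sub_cancel_right, mul_one, rho]
    rw [e3, e4, show n + 1 - m = n - m + 1 by omega, pow_succ (t - 1) (n - m), pow_succ t m]
    rw [hc] at p1 ⊢
    linear_combination (-(jacobiCoeff (a + 1) (b + 1) n m * (1 - t) ^ a * t ^ b)) *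
      (t * t ^ m * p1 + (t - 1) * (t - 1) ^ (n - m) * p2)
  rw [hfun]
  refine (HasDerivAt.fun_sum hterm).congr_deriv ?_
  rw [← Finset.mul_sum]
  simp only [mul_add, Finset.sum_add_distrib]
  suffices hsum : ((n : ℝ) + 1) * jacobiG a b (n + 1) t =
      ∑ m ∈ Finset.range (n + 1), jacobiCoeff (a + 1) (b + 1) n m *
        ((a + 1 + n - m) * ((t - 1) ^ (n - m) * t ^ (m + 1))) +
      ∑ m ∈ Finset.range (n + 1), jacobiCoeff (a + 1) (b + 1) n m *
        ((b + 1 + m) * ((t - 1) ^ (n + 1 - m) * t ^ m)) by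
    linear_combination rho a b t * hsum
  have hsplit : ((n : ℝ) + 1) * jacobiG a b (n + 1) t =
      ∑ m ∈ Finset.range (n + 1 + 1), (m : ℝ) * (jacobiCoeff a b (n + 1) m *
        ((t - 1) ^ (n + 1 - m) * t ^ m)) +
      ∑ m ∈ Finset.range (n + 1 + 1), ((n : ℝ) + 1 - m) * (jacobiCoeff a b (n + 1) m *
        ((t - 1) ^ (n + 1 - m) * t ^ m)) := by
    rw [← Finset.sum_add_distrib, jacobiG_eq_sum, Finset.mul_sum]
    exact Finset.sum_congr rfl fun m _ => by ring
  rw [hsplit, Finset.sum_range_succ', Finset.sum_range_succ (fun m => ((n : ℝ) + 1 - (m : ℕ)) *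
    (jacobiCoeff a b (n + 1) m * ((t - 1) ^ (n + 1 - m) * t ^ m)))]
  push_cast
  simp only [zero_mul, add_zero, sub_self]
  congr 1
  · refine Finset.sum_congr rfl fun m hm => ?_
    have hmn : m ≤ n := Nat.lt_succ_iff.mp (Finset.mem_range.mp hm)
    have r2 := jacobiCoeff_succ_succ_mul_shift (b := b) ha hmn
    linear_combination (-((t - 1) ^ (n - m) * t ^ (m + 1))) * r2
  · refine Finset.sum_congr rfl fun m hm => ?_
    have hmn : m ≤ n := Nat.lt_succ_iff.mp (Finset.mem_range.mp hm)
    have r1 := jacobiCoeff_succ_succ_mul (a := a) hb hmn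
    linear_combination (-((t - 1) ^ (n + 1 - m) * t ^ m)) * r1

lemma rho_zero {a b : ℝ} (hb : 0 < b) : rho a b 0 = 0 := by
  simp [rho, Real.zero_rpow hb.ne']

lemma rho_one {a b : ℝ} (ha : 0 < a) : rho a b 1 = 0 := by
  simp [rho, Real.zero_rpow ha.ne']

/-- The weighted antiderivative of a shifted Jacobi polynomial vanishing at `0`. -/
lemma integral_rho_mul_jacobiG_succ {a b : ℝ} (ha : 0 ≤ a) (hb : 0 ≤ b) (n : ℕ) {x : ℝ}
    (hx0 : 0 ≤ x) (hx1 : x ≤ 1) :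
    ∫ s in (0 : ℝ)..x, rho a b s * jacobiG a b (n + 1) s =
      -(rho (a + 1) (b + 1) x * jacobiG (a + 1) (b + 1) n x) / ((n : ℝ) + 1) := by
  have hcont : Continuous fun s => -((n : ℝ) + 1) * (rho a b s * jacobiG a b (n + 1) s) :=
    continuous_const.mul ((continuous_rho ha hb).mul (continuous_jacobiG _ _ _))
  have h := intervalIntegral.integral_eq_sub_of_hasDerivAt (a := 0) (b := x)
    (fun t ht => by
      rw [Set.uIcc_of_le hx0] at ht
      exact hasDerivAt_rho_mul_jacobiG ha hb n ht.1 (ht.2.trans hx1))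
    (hcont.intervalIntegrable _ _)
  rw [intervalIntegral.integral_const_mul, rho_zero (by linarith)] at h
  have hn : (n : ℝ) + 1 ≠ 0 := by positivity
  rw [eq_div_iff hn]
  linear_combination -h

/-- The Beta integral in terms of the weight `ρ`. -/
lemma integral_rho {a b : ℝ} (ha : 0 ≤ a) (hb : 0 ≤ b) :
    ∫ x in (0 : ℝ)..1, rho a b x = Gnorm2 a b 0 := by
  have hre : Complex.betaIntegral ((b + 1 : ℝ) : ℂ) ((a + 1 : ℝ) : ℂ) =
      ((∫ x in (0 : ℝ)..1, rho a b x : ℝ) : ℂ) := by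
    rw [Complex.betaIntegral, ← intervalIntegral.integral_ofReal]
    refine intervalIntegral.integral_congr fun x hx => ?_
    rw [Set.uIcc_of_le zero_le_one] at hx
    simp only [rho]
    rw [Complex.ofReal_mul, Complex.ofReal_cpow (by linarith [hx.2]), Complex.ofReal_cpow hx.1]
    push_cast
    simp [mul_comm]
  have hbeta := ProbabilityTheory.beta_eq_betaIntegralReal (b + 1) (a + 1)
    (by linarith) (by linarith)
  rw [hre, Complex.ofReal_re] at hbeta
  rw [← hbeta, ProbabilityTheory.beta, Gnorm2]
  have hab : Real.Gamma (b + 1 + (a + 1)) = (a + b + 1) * Real.Gamma (a + b + 1) := by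
    rw [← Real.Gamma_add_one (by linarith)]
    congr 1
    ring
  rw [hab]
  simp [mul_comm]

lemma Gnorm2_succ {a b : ℝ} (ha : 0 ≤ a) (hb : 0 ≤ b) (n : ℕ) :
    ((n : ℝ) + 1) * Gnorm2 a b (n + 1) =
      ((n : ℝ) + a + b + 2) * Gnorm2 (a + 1) (b + 1) n := by
  have hn : (0 : ℝ) ≤ n := n.cast_nonneg
  have e1 : Real.Gamma ((n : ℝ) + 1 + 1) = (n + 1) * Real.Gamma (n + 1) :=
    Real.Gamma_add_one (by positivity)
  have e2 : Real.Gamma ((n : ℝ) + (a + 1) + (b + 1) + 1) =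
      (n + a + b + 2) * Real.Gamma (n + a + b + 2) := by
    rw [← Real.Gamma_add_one (by positivity)]
    congr 1
    ring
  unfold Gnorm2
  push_cast
  rw [e1, e2, show (n : ℝ) + 1 + a + 1 = n + (a + 1) + 1 by ring,
    show (n : ℝ) + 1 + b + 1 = n + (b + 1) + 1 by ring,
    show (n : ℝ) + 1 + a + b + 1 = n + a + b + 2 by ring,
    show 2 * ((n : ℝ) + 1) + a + b + 1 = 2 * n + (a + 1) + (b + 1) + 1 by ring]
  have h1 : (n : ℝ) + a + b + 2 ≠ 0 := by positivity
  have h2 : (n : ℝ) + 1 ≠ 0 := by positivity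
  have h3 : Real.Gamma ((n : ℝ) + a + b + 2) ≠ 0 := (Real.Gamma_pos_of_pos (by positivity)).ne'
  have h4 : Real.Gamma ((n : ℝ) + 1) ≠ 0 := (Real.Gamma_pos_of_pos (by positivity)).ne'
  have h5 : 2 * (n : ℝ) + (a + 1) + (b + 1) + 1 ≠ 0 := by positivity
  field_simp

lemma integral_rho_mul_jacobiG_succ_mul_succ {a b : ℝ} (ha : 0 ≤ a) (hb : 0 ≤ b) (n m : ℕ) :
    ((n : ℝ) + 1) * ∫ x in (0 : ℝ)..1,
        rho a b x * jacobiG a b (n + 1) x * jacobiG a b (m + 1) x =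
      ((m : ℝ) + a + b + 2) * ∫ x in (0 : ℝ)..1,
        rho (a + 1) (b + 1) x * jacobiG (a + 1) (b + 1) n x * jacobiG (a + 1) (b + 1) m x := by
  have hcont : Continuous fun s => -((n : ℝ) + 1) * (rho a b s * jacobiG a b (n + 1) s) :=
    continuous_const.mul ((continuous_rho ha hb).mul (continuous_jacobiG _ _ _))
  have h := intervalIntegral.integral_mul_deriv_eq_deriv_mul (a := 0) (b := 1)
    (fun t ht => by
      rw [Set.uIcc_of_le zero_le_one] at ht
      exact hasDerivAt_rho_mul_jacobiG ha hb n ht.1 ht.2)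
    (fun t _ => hasDerivAt_jacobiG_succ ha hb m t)
    (hcont.intervalIntegrable _ _)
    ((continuous_const.mul (continuous_jacobiG _ _ _)).intervalIntegrable _ _)
  rw [rho_zero (by linarith), rho_one (by linarith)] at h
  simp only [zero_mul, sub_self, zero_sub] at h
  rw [← intervalIntegral.integral_const_mul, ← intervalIntegral.integral_const_mul]
  rw [← intervalIntegral.integral_neg] at h
  convert h.symm using 3 <;> ring

/-- Orthogonality of the shifted Jacobi polynomials. -/
lemma integral_rho_mul_jacobiG_mul_jacobiG {a b : ℝ} (ha : 0 ≤ a) (hb : 0 ≤ b) (n m : ℕ) :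
    ∫ x in (0 : ℝ)..1, rho a b x * jacobiG a b n x * jacobiG a b m x =
      if n = m then Gnorm2 a b n else 0 := by
  have hsucc : ∀ k : ℕ, ∫ x in (0 : ℝ)..1, rho a b x * jacobiG a b (k + 1) x = 0 := by
    intro k
    rw [integral_rho_mul_jacobiG_succ ha hb k zero_le_one le_rfl, rho_one (by linarith)]
    simp
  induction n generalizing a b m with
  | zero =>
    cases m with
    | zero => simp [jacobiG_zero ha hb, integral_rho ha hb]
    | succ m => simp [jacobiG_zero ha hb, hsucc]
  | succ n ih =>
    cases m with
    | zero => simp [jacobiG_zero ha hb, hsucc]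
    | succ m =>
      have hn : (n : ℝ) + 1 ≠ 0 := by positivity
      have ha' : 0 ≤ a + 1 := by linarith
      have hb' : 0 ≤ b + 1 := by linarith
      apply mul_left_cancel₀ hn
      rw [integral_rho_mul_jacobiG_succ_mul_succ ha hb, ih ha' hb' m fun k => by
        rw [integral_rho_mul_jacobiG_succ ha' hb' k zero_le_one le_rfl, rho_one (by linarith)]
        simp]
      by_cases hnm : n = m
      · subst hnm
        simp [Gnorm2_succ ha hb]
      · simp [hnm]

lemma integral_rho_mul_sum_jacobiG_sq {a b : ℝ} (ha : 0 ≤ a) (hb : 0 ≤ b) (s : Finset ℕ)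
    (d : ℕ → ℝ) :
    ∫ x in (0 : ℝ)..1, rho a b x * (∑ i ∈ s, d i * jacobiG a b i x) ^ 2 =
      ∑ i ∈ s, d i ^ 2 * Gnorm2 a b i := by
  have hexp : ∀ x, rho a b x * (∑ i ∈ s, d i * jacobiG a b i x) ^ 2 =
      ∑ i ∈ s, ∑ j ∈ s, d i * d j * (rho a b x * jacobiG a b i x * jacobiG a b j x) := by
    intro x
    rw [sq, Finset.sum_mul_sum, Finset.mul_sum]
    refine Finset.sum_congr rfl fun i _ => ?_
    rw [Finset.mul_sum]
    exact Finset.sum_congr rfl fun j _ => by ring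
  have hcont : ∀ i j, Continuous fun x =>
      d i * d j * (rho a b x * jacobiG a b i x * jacobiG a b j x) := fun i j =>
    continuous_const.mul (((continuous_rho ha hb).mul (continuous_jacobiG _ _ _)).mul
      (continuous_jacobiG _ _ _))
  simp only [hexp]
  rw [intervalIntegral.integral_finsetSum fun i _ =>
    (continuous_finsetSum s fun j _ => hcont i j).intervalIntegrable _ _]
  refine Finset.sum_congr rfl fun i hi => ?_
  rw [intervalIntegral.integral_finsetSum fun j _ => (hcont i j).intervalIntegrable _ _]
  simp only [intervalIntegral.integral_const_mul, integral_rho_mul_jacobiG_mul_jacobiG ha hb]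
  simp [hi, sq]

lemma rpow_neg_mul_rpow_sq {r p : ℝ} (hr : 0 ≤ r) (hp : 0 < p) :
    r ^ (-p) * (r ^ p) ^ 2 = r ^ p := by
  rcases hr.eq_or_lt with rfl | hr
  · simp [Real.zero_rpow hp.ne']
  · have h : r ^ p ≠ 0 := (Real.rpow_pos_of_pos hr p).ne'
    rw [Real.rpow_neg hr.le]
    field_simp

lemma rho_neg_mul_rho_sq {a b x : ℝ} (ha : 0 < a) (hb : 0 < b) (hx0 : 0 ≤ x) (hx1 : x ≤ 1) :
    rho (-a) (-b) x * rho a b x ^ 2 = rho a b x := by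
  have h1 := rpow_neg_mul_rpow_sq (r := 1 - x) (by linarith) ha
  have h2 := rpow_neg_mul_rpow_sq hx0 hb
  unfold rho
  linear_combination x ^ (-b) * (x ^ b) ^ 2 * h1 + (1 - x) ^ a * h2

/-- Parseval identity for weighted antiderivatives of shifted Jacobi expansions. -/
lemma integral_rho_neg_mul_antideriv_sq {a b : ℝ} (ha : 0 ≤ a) (hb : 0 ≤ b) (s : Finset ℕ)
    (c : ℕ → ℝ) :
    ∫ x in (0 : ℝ)..1, rho (-(a + 1)) (-(b + 1)) x *
        (∫ y in (0 : ℝ)..x, rho a b y * ∑ k ∈ s, c k * jacobiG a b (k + 1) y) ^ 2 =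
      ∑ k ∈ s, (c k / ((k : ℝ) + 1)) ^ 2 * Gnorm2 (a + 1) (b + 1) k := by
  rw [← integral_rho_mul_sum_jacobiG_sq (by linarith) (by linarith)]
  refine intervalIntegral.integral_congr fun x hx => ?_
  rw [Set.uIcc_of_le zero_le_one] at hx
  have hinner : (∫ y in (0 : ℝ)..x, rho a b y * ∑ k ∈ s, c k * jacobiG a b (k + 1) y) =
      -(rho (a + 1) (b + 1) x *
        ∑ k ∈ s, c k / ((k : ℝ) + 1) * jacobiG (a + 1) (b + 1) k x) := by
    have hexp : ∀ y, rho a b y * ∑ k ∈ s, c k * jacobiG a b (k + 1) y =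
        ∑ k ∈ s, c k * (rho a b y * jacobiG a b (k + 1) y) := fun y => by
      rw [Finset.mul_sum]
      exact Finset.sum_congr rfl fun k _ => by ring
    simp only [hexp]
    have hcont : ∀ k, Continuous fun y => c k * (rho a b y * jacobiG a b (k + 1) y) := fun k =>
      continuous_const.mul ((continuous_rho ha hb).mul (continuous_jacobiG _ _ _))
    rw [intervalIntegral.integral_finsetSum fun k _ => (hcont k).intervalIntegrable _ _,
      Finset.mul_sum, ← Finset.sum_neg_distrib]
    refine Finset.sum_congr rfl fun k _ => ?_
    rw [intervalIntegral.integral_const_mul, integral_rho_mul_jacobiG_succ ha hb k hx.1 hx.2]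
    ring
  simp only [hinner]
  have hrho := rho_neg_mul_rho_sq (a := a + 1) (b := b + 1) (by linarith) (by linarith) hx.1 hx.2
  linear_combination
    (∑ k ∈ s, c k / ((k : ℝ) + 1) * jacobiG (a + 1) (b + 1) k x) ^ 2 * hrho

lemma Gnorm2_pos {a b : ℝ} {n : ℕ} (ha : -1 < a) (hb : -1 < b) (hn : 1 ≤ n) :
    0 < Gnorm2 a b n := by
  have hn' : (1 : ℝ) ≤ n := by exact_mod_cast hn
  unfold Gnorm2
  have h1 := Real.Gamma_pos_of_pos (show 0 < (n : ℝ) + a + 1 by linarith)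
  have h2 := Real.Gamma_pos_of_pos (show 0 < (n : ℝ) + b + 1 by linarith)
  have h3 := Real.Gamma_pos_of_pos (show 0 < (n : ℝ) + 1 by linarith)
  have h4 := Real.Gamma_pos_of_pos (show 0 < (n : ℝ) + a + b + 1 by linarith)
  have h5 : 0 < 2 * (n : ℝ) + a + b + 1 := by linarith
  positivity

/-- Comparison of norm constants whose parameters are reflected and shifted by two. -/
lemma Gnorm2_succ_succ_le {a b : ℝ} (ha : 0 ≤ a) (hb : 0 ≤ b) (k : ℕ) (hab : 1 ≤ a + b) :
    Gnorm2 (a + 1) (b + 1) k ≤ Gnorm2 (b - 1) (a - 1) (k + 2) := by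
  have hk : (0 : ℝ) ≤ k := k.cast_nonneg
  unfold Gnorm2
  push_cast
  rw [show (k : ℝ) + 2 + (b - 1) + 1 = k + (b + 1) + 1 by ring,
    show (k : ℝ) + 2 + (a - 1) + 1 = k + (a + 1) + 1 by ring,
    show 2 * ((k : ℝ) + 2) + (b - 1) + (a - 1) + 1 = 2 * k + (a + 1) + (b + 1) + 1 by ring,
    show (k : ℝ) + 2 + (b - 1) + (a - 1) + 1 = k + a + b + 1 by ring,
    mul_comm (Real.Gamma ((k : ℝ) + (b + 1) + 1))]
  have e1 : Real.Gamma ((k : ℝ) + 2 + 1) = (k + 2) * ((k + 1) * Real.Gamma (k + 1)) := by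
    rw [Real.Gamma_add_one (by positivity), show (k : ℝ) + 2 = k + 1 + 1 by ring,
      Real.Gamma_add_one (by positivity)]
  have e2 : Real.Gamma ((k : ℝ) + (a + 1) + (b + 1) + 1) =
      (k + a + b + 2) * ((k + a + b + 1) * Real.Gamma (k + a + b + 1)) := by
    rw [← Real.Gamma_add_one (by positivity), show (k : ℝ) + a + b + 1 + 1 = k + a + b + 2 by ring,
      ← Real.Gamma_add_one (by positivity)]
    congr 1
    ring
  have h1 := Real.Gamma_pos_of_pos (show 0 < (k : ℝ) + (a + 1) + 1 by linarith)
  have h2 := Real.Gamma_pos_of_pos (show 0 < (k : ℝ) + (b + 1) + 1 by linarith)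
  have h3 := Real.Gamma_pos_of_pos (show 0 < (k : ℝ) + 1 by linarith)
  have h4 := Real.Gamma_pos_of_pos (show 0 < (k : ℝ) + a + b + 1 by linarith)
  have h5 : 0 < 2 * (k : ℝ) + (a + 1) + (b + 1) + 1 := by linarith
  rw [e1, e2]
  refine div_le_div_of_nonneg_left (by positivity) (by positivity) ?_
  have hfac : ((k : ℝ) + 2) * (k + 1) ≤ (k + a + b + 2) * (k + a + b + 1) := by
    apply mul_le_mul <;> linarith
  have hG := mul_le_mul_of_nonneg_left hfac (show 0 ≤ (2 * (k : ℝ) + (a + 1) + (b + 1) + 1) *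
    Real.Gamma (k + 1) * Real.Gamma (k + a + b + 1) by positivity)
  linarith

/-- A Gautschi-type lower bound for the ratio of Gamma values. -/
lemma half_mul_rpow_mul_Gamma_le {x s : ℝ} (hx : 1 ≤ x) (hs0 : 0 < s) (hs1 : s < 1) :
    x ^ s / 2 * Real.Gamma x ≤ Real.Gamma (x + s) := by
  have hxs : 0 < x + s := by linarith
  have hG := Real.Gamma_pos_of_pos hxs
  have hGx := Real.Gamma_pos_of_pos (show 0 < x by linarith)
  have hconv := Real.Gamma_mul_add_mul_le_rpow_Gamma_mul_rpow_Gamma (s := x + s) (t := x + s + 1)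
    (a := s) (b := 1 - s) hxs (by linarith) hs0 (by linarith) (by ring)
  rw [show s * (x + s) + (1 - s) * (x + s + 1) = x + 1 by ring,
    Real.Gamma_add_one (by linarith), Real.Gamma_add_one hxs.ne',
    Real.mul_rpow hxs.le hG.le, mul_left_comm, ← Real.rpow_add hG, add_sub_cancel,
    Real.rpow_one] at hconv
  have hpow : (x + s) ^ (1 - s) ≤ 2 * x ^ (1 - s) := by
    calc (x + s) ^ (1 - s) ≤ (2 * x) ^ (1 - s) :=
          Real.rpow_le_rpow hxs.le (by linarith) (by linarith)
      _ = 2 ^ (1 - s) * x ^ (1 - s) := Real.mul_rpow (by norm_num) (by linarith)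
      _ ≤ 2 * x ^ (1 - s) := by
          gcongr
          exact (Real.rpow_le_rpow_of_exponent_le (by norm_num)
            (show 1 - s ≤ 1 by linarith)).trans_eq (Real.rpow_one 2)
  have hsplit : x = x ^ s * x ^ (1 - s) := by
    rw [← Real.rpow_add (by linarith), add_sub_cancel, Real.rpow_one]
  have hpos : 0 < x ^ (1 - s) := Real.rpow_pos_of_pos (by linarith) _
  have hchain : x * Real.Gamma x ≤ 2 * x ^ (1 - s) * Real.Gamma (x + s) :=
    hconv.trans (mul_le_mul_of_nonneg_right hpow hG.le)
  refine le_of_mul_le_mul_left ?_ (show 0 < 2 * x ^ (1 - s) by positivity)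
  calc 2 * x ^ (1 - s) * (x ^ s / 2 * Real.Gamma x)
      = x ^ s * x ^ (1 - s) * Real.Gamma x := by ring
    _ = x * Real.Gamma x := by rw [← hsplit]
    _ ≤ _ := hchain

/-- The constant factor of the eigenvalues `λ_n`. -/
noncomputable def lamdaConst (α β : ℝ) : ℝ :=
  Real.sin (π * α) / (Real.sin (π * (α - β)) + Real.sin (π * β))

lemma inv_lamda_sq_le {α : ℝ} (β : ℝ) (hα1 : 1 < α) (hα2 : α < 2) {N i : ℕ} (hNi : N ≤ i) :
    (lamda α β i ^ 2)⁻¹ ≤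
      4 * (lamdaConst α β ^ 2)⁻¹ * ((N : ℝ) + 1) ^ (-2 * (α - 1)) := by
  have hi : (0 : ℝ) ≤ i := i.cast_nonneg
  have hNi' : (N : ℝ) ≤ i := by exact_mod_cast hNi
  have hN : (0 : ℝ) < (N : ℝ) + 1 := by positivity
  have hG : ((N : ℝ) + 1) ^ (α - 1) / 2 ≤ Real.Gamma (i + α) / (i.factorial : ℝ) := by
    have h := half_mul_rpow_mul_Gamma_le (x := (i : ℝ) + 1) (s := α - 1) (by linarith)
      (by linarith) (by linarith)
    rw [Real.Gamma_nat_eq_factorial, show (i : ℝ) + 1 + (α - 1) = i + α by ring] at h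
    rw [le_div_iff₀ (by positivity)]
    refine le_trans ?_ h
    gcongr
  have hpos : 0 < ((N : ℝ) + 1) ^ (α - 1) := Real.rpow_pos_of_pos hN _
  have hrpow : ((N : ℝ) + 1) ^ (-2 * (α - 1)) = ((((N : ℝ) + 1) ^ (α - 1)) ^ 2)⁻¹ := by
    rw [show -2 * (α - 1) = -((α - 1) * (2 : ℕ)) by push_cast; ring, Real.rpow_neg hN.le,
      Real.rpow_mul_natCast hN.le]
  rw [hrpow, lamda, mul_pow, mul_inv]
  change (lamdaConst α β ^ 2)⁻¹ * _ ≤ _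
  have hinv : ((Real.Gamma (i + α) / (i.factorial : ℝ)) ^ 2)⁻¹ ≤
      4 * ((((N : ℝ) + 1) ^ (α - 1)) ^ 2)⁻¹ := by
    calc _ ≤ ((((N : ℝ) + 1) ^ (α - 1) / 2) ^ 2)⁻¹ := by gcongr
      _ = _ := by field_simp; norm_num
  calc _ ≤ (lamdaConst α β ^ 2)⁻¹ * (4 * ((((N : ℝ) + 1) ^ (α - 1)) ^ 2)⁻¹) := by gcongr
    _ = _ := by ring

/-- Cauchy-sequence estimate for the partial sums of `u_N` (antiderivatives of the
spectral expansion) in the `ρ^{(-(α-β+1),-(β+1))}`-weighted `L²` norm. -/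
theorem uN_cauchy_bound (α β : ℝ) (hα1 : 1 < α) (hα2 : α < 2)
    (hβ1 : α - 1 ≤ β) (hβ2 : β ≤ 1) :
    ∃ C : ℝ, 0 < C ∧
      ∀ f : ℝ → ℝ,
        IntegrableOn (fun x => rho (β - 1) (α - β - 1) x * f x ^ 2) (Set.Ioo 0 1) →
        ∀ fc : ℕ → ℝ,
          (∀ i, fc i = ∫ x in (0:ℝ)..1,
              rho (β - 1) (α - β - 1) x * f x * jacobiG (β - 1) (α - β - 1) i x) →
        ∀ c : ℕ → ℝ,
          (∀ i, c i = fc (i + 1) / (lamda α β i * Gnorm2 (β - 1) (α - β - 1) (i + 1))) →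
        ∀ M N : ℕ, 1 ≤ N → N < M →
          (∫ x in (0:ℝ)..1, rho (-(α - β + 1)) (-(β + 1)) x *
              (∫ s in (0:ℝ)..x,
                rho (α - β) β s * ∑ i ∈ Finset.Ico N M, c i * jacobiG (α - β) β i s) ^ 2) ≤
            C * (N : ℝ) ^ (-(2:ℝ)) * ((N : ℝ) + 1) ^ (-2 * (α - 1)) *
              ∑ i ∈ Finset.Icc (N + 1) M, fc i ^ 2 / Gnorm2 (β - 1) (α - β - 1) i := by
  have ha : 0 ≤ α - β := by linarith
  have hb : 0 ≤ β := by linarith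
  refine ⟨4 * (lamdaConst α β ^ 2)⁻¹ + 1, by positivity, ?_⟩
  intro f _ fc _ c hc M N hN hNM
  obtain ⟨n, rfl⟩ : ∃ n, N = n + 1 := ⟨N - 1, by omega⟩
  obtain ⟨m, rfl⟩ : ∃ m, M = m + 1 := ⟨M - 1, by omega⟩
  have hIco : ∀ g : ℕ → ℝ, ∑ i ∈ Finset.Ico (n + 1) (m + 1), g i =
      ∑ k ∈ Finset.Ico n m, g (k + 1) := fun g => (Finset.sum_Ico_add' g n m 1).symm
  have hIcc : ∀ g : ℕ → ℝ, ∑ i ∈ Finset.Icc (n + 1 + 1) (m + 1), g i =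
      ∑ k ∈ Finset.Ico n m, g (k + 2) := fun g => by
    rw [Finset.sum_Ico_add' g n m 2]
    exact Finset.sum_congr (by ext; simp; omega) fun _ _ => rfl
  simp only [hIco, hIcc]
  rw [integral_rho_neg_mul_antideriv_sq ha hb (Finset.Ico n m) fun k => c (k + 1),
    Finset.mul_sum]
  refine Finset.sum_le_sum fun k hk => ?_
  have hnk : n ≤ k := (Finset.mem_Ico.mp hk).1
  have hnk' : (n : ℝ) ≤ k := by exact_mod_cast hnk
  have hpos : 0 < Gnorm2 (β - 1) (α - β - 1) (k + 2) :=
    Gnorm2_pos (by linarith) (by linarith) (by omega)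
  have hle := Gnorm2_succ_succ_le ha hb k (by linarith)
  have hlam := inv_lamda_sq_le β hα1 hα2 (show n + 1 ≤ k + 1 by omega)
  have hrpow0 : 0 ≤ (((n + 1 : ℕ) : ℝ) + 1) ^ (-2 * (α - 1)) := by positivity
  have hN2 : ((n + 1 : ℕ) : ℝ) ^ (-(2 : ℝ)) = (((n : ℝ) + 1) ^ 2)⁻¹ := by
    rw [Real.rpow_neg (by positivity)]
    norm_cast
  have hk2 : (((k : ℝ) + 1) ^ 2)⁻¹ ≤ (((n : ℝ) + 1) ^ 2)⁻¹ := by gcongr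
  rw [hc, show k + 1 + 1 = k + 2 from rfl, hN2]
  calc (fc (k + 2) / (lamda α β (k + 1) * Gnorm2 (β - 1) (α - β - 1) (k + 2)) /
          ((k : ℝ) + 1)) ^ 2 * Gnorm2 (α - β + 1) (β + 1) k
      ≤ (fc (k + 2) / (lamda α β (k + 1) * Gnorm2 (β - 1) (α - β - 1) (k + 2)) /
          ((k : ℝ) + 1)) ^ 2 * Gnorm2 (β - 1) (α - β - 1) (k + 2) := by gcongr
    _ = (lamda α β (k + 1) ^ 2)⁻¹ * (((k : ℝ) + 1) ^ 2)⁻¹ *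
          (fc (k + 2) ^ 2 / Gnorm2 (β - 1) (α - β - 1) (k + 2)) := by
        simp only [div_eq_mul_inv, mul_inv, mul_pow, inv_pow]
        field_simp
    _ ≤ ((4 * (lamdaConst α β ^ 2)⁻¹ + 1) * (((n + 1 : ℕ) : ℝ) + 1) ^ (-2 * (α - 1))) *
          (((n : ℝ) + 1) ^ 2)⁻¹ * (fc (k + 2) ^ 2 / Gnorm2 (β - 1) (α - β - 1) (k + 2)) := by
        gcongr
        linarith
    _ = _ := by ring
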